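/- Suppose a ring T is separable over a subring S. Then every left T-module that is flat as a left S-module is also flat as a left T-module. -/

import Mathlib

/-! ### Separability of ring extensions -/

universe usep

/-- The families `x y : Fin n → T` represent a separability idempotent
`ω = Σᵢ xᵢ ⊗ yᵢ ∈ T ⊗_S T` for the ring extension `f : S → T`: `Σᵢ xᵢ yᵢ = 1` and
`t ω = ω t` for all `t ∈ T`, where equality of elements of `T ⊗_S T` is expressed
through all `S`-balanced biadditive maps out of `T × T` (the universal property of
the tensor product of the `(T,S)`-bimodule `T` with the `(S,T)`-bimodule `T`). -/
def IsSeparabilityIdempotent {S : Type*} {T : Type usep} [Ring S] [Ring T] (f : S →+* T)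
    {n : ℕ} (x y : Fin n → T) : Prop :=
  (∑ i, x i * y i) = 1 ∧
  ∀ (M : Type usep) [AddCommGroup M] (β : T → T → M),
    (∀ t₁ t₂ u, β (t₁ + t₂) u = β t₁ u + β t₂ u) →
    (∀ t u₁ u₂, β t (u₁ + u₂) = β t u₁ + β t u₂) →
    (∀ (s : S) (t u : T), β (t * f s) u = β t (f s * u)) →
    ∀ t : T, (∑ i, β (t * x i) (y i)) = ∑ i, β (x i) (y i * t)

/-- The ring extension `f : S → T` is separable: there exists a separability
idempotent `ω ∈ T ⊗_S T`. -/
def IsSeparableExtension {S : Type*} {T : Type usep} [Ring S] [Ring T] (f : S →+* T) : Prop :=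
  ∃ (n : ℕ) (x y : Fin n → T), IsSeparabilityIdempotent f x y

/-- Flatness of the left `S`-module `M`, via the equational criterion (the standard
characterisation of flatness, valid over noncommutative rings): every finite linear
relation in `M` is trivial. -/
def IsFlatModule (S M : Type*) [Ring S] [AddCommGroup M] [Module S M] : Prop :=
  ∀ (n : ℕ) (x : Fin n → S) (m : Fin n → M), (∑ i, x i • m i) = 0 →
    ∃ (k : ℕ) (a : Fin n → Fin k → S) (m' : Fin k → M),
      (∀ i, m i = ∑ j, a i j • m' j) ∧ ∀ j, (∑ i, x i * a i j) = 0

/-- The balancing identity of a separability idempotent holds for balanced biadditive maps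
into abelian groups of any universe. -/
theorem IsSeparabilityIdempotent.sum_balanced_eq {S : Type*} {T : Type usep} [Ring S] [Ring T]
    {f : S →+* T} {n : ℕ} {x y : Fin n → T} (h : IsSeparabilityIdempotent f x y)
    {A : Type*} [AddCommGroup A] (β : T → T → A)
    (hadd_left : ∀ t₁ t₂ u, β (t₁ + t₂) u = β t₁ u + β t₂ u)
    (hadd_right : ∀ t u₁ u₂, β t (u₁ + u₂) = β t u₁ + β t u₂)
    (hbal : ∀ (s : S) (t u : T), β (t * f s) u = β t (f s * u)) (t : T) :
    (∑ i, β (t * x i) (y i)) = ∑ i, β (x i) (y i * t) := by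
  let L : FreeAbelianGroup (T × T) →+ A := FreeAbelianGroup.lift fun p => β p.1 p.2
  have hL (a b : T) : L (FreeAbelianGroup.of (a, b)) = β a b := by simp [L]
  -- The kernel of `L` has a quotient in the universe of `T`.
  let q := QuotientAddGroup.mk' L.ker
  have hq (a b : FreeAbelianGroup (T × T)) (hab : L a = L b) : q a = q b := by
    refine (QuotientAddGroup.eq).2 ?_
    simp [AddMonoidHom.mem_ker, hab]
  have key := h.2 (FreeAbelianGroup (T × T) ⧸ L.ker)
    (fun a b => q (FreeAbelianGroup.of (a, b)))
    (fun a b c => by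
      rw [← map_add]; apply hq; rw [map_add, hL, hL, hL, hadd_left])
    (fun a b c => by
      rw [← map_add]; apply hq; rw [map_add, hL, hL, hL, hadd_right])
    (fun s a b => by apply hq; rw [hL, hL, hbal]) t
  have := congrArg (QuotientAddGroup.kerLift L) key
  simpa [q, QuotientAddGroup.kerLift_mk, hL] using this

namespace FreeCover

variable {T : Type*} [Ring T] (S : Subring T) (M : Type*)

/-- The canonical surjection from the free module on `M` to `M`. -/
noncomputable def proj (R N : Type*) [Ring R] [AddCommGroup N] [Module R N] :
    (N →₀ R) →ₗ[R] N :=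
  Finsupp.linearCombination R id

@[simp]
theorem proj_single {R N : Type*} [Ring R] [AddCommGroup N] [Module R N] (m : N) (r : R) :
    proj R N (Finsupp.single m r) = r • m := by
  simp [proj]

/-- The inclusion of the free `S`-module on `M` into the free `T`-module on `M`. -/
noncomputable def incl : (M →₀ S) →ₗ[S] (M →₀ T) :=
  Finsupp.linearCombination S fun m => Finsupp.single m (1 : T)

variable {S M}

@[simp]
theorem incl_single (m : M) (s : S) :
    incl S M (Finsupp.single m s) = Finsupp.single m (s : T) := by
  simp [incl, Subring.smul_def]

/-- Base change to `T` of an endomorphism of the free `S`-module on `M`. -/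
noncomputable def extend (φ : (M →₀ S) →ₗ[S] (M →₀ S)) : (M →₀ T) →ₗ[T] (M →₀ T) :=
  Finsupp.linearCombination T fun m => incl S M (φ (Finsupp.single m 1))

@[simp]
theorem extend_single (φ : (M →₀ S) →ₗ[S] (M →₀ S)) (m : M) (t : T) :
    extend φ (Finsupp.single m t) = t • incl S M (φ (Finsupp.single m 1)) := by
  simp [extend]

theorem extend_incl (φ : (M →₀ S) →ₗ[S] (M →₀ S)) (r : M →₀ S) :
    extend φ (incl S M r) = incl S M (φ r) := by
  induction r using Finsupp.induction_linear with
  | zero => simp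
  | add f g hf hg => simp only [map_add, hf, hg]
  | single m s =>
    have : Finsupp.single m s = s • Finsupp.single m (1 : S) := by simp
    rw [incl_single, extend_single, this, map_smul, map_smul, Subring.smul_def]

theorem extend_comp (χ φ : (M →₀ S) →ₗ[S] (M →₀ S)) (f : M →₀ T) :
    extend (χ ∘ₗ φ) f = extend χ (extend φ f) := by
  induction f using Finsupp.induction_linear with
  | zero => simp
  | add f g hf hg => simp only [map_add, hf, hg]
  | single m t => simp [extend_incl]

theorem extend_congr {φ ψ : (M →₀ S) →ₗ[S] (M →₀ S)} {f : M →₀ T}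
    (h : ∀ m ∈ f.support, φ (Finsupp.single m 1) = ψ (Finsupp.single m 1)) :
    extend φ f = extend ψ f := by
  simp only [extend, Finsupp.linearCombination_apply]
  exact Finsupp.sum_congr fun m hm => by rw [h m hm]

variable [AddCommGroup M] [Module T M]

theorem proj_incl (r : M →₀ S) : proj T M (incl S M r) = proj S M r := by
  induction r using Finsupp.induction_linear with
  | zero => simp
  | add f g hf hg => simp only [map_add, hf, hg]
  | single m s => simp [Subring.smul_def]

/-- Over a flat module, a single relation is killed by an endomorphism of the free cover
lying over the identity. -/
theorem exists_endo_apply_eq_zero {R N : Type*} [Ring R] [AddCommGroup N] [Module R N]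
    (hflat : IsFlatModule R N) (r : N →₀ R) (hr : proj R N r = 0) :
    ∃ φ : (N →₀ R) →ₗ[R] (N →₀ R), proj R N ∘ₗ φ = proj R N ∧ φ r = 0 := by
  classical
  let e := r.support.equivFin
  obtain ⟨k, a, m', hm, ha⟩ := hflat _ (fun i => r (e.symm i)) (fun i => (e.symm i : N)) (by
    rw [e.symm.sum_comp (fun p : r.support => r p • (p : N)),
      Finset.sum_coe_sort r.support (fun p => r p • p), ← hr]
    simp [proj, Finsupp.linearCombination_apply, Finsupp.sum])
  let v : N → N →₀ R := fun m =>
    if h : m ∈ r.support then ∑ j, Finsupp.single (m' j) (a (e ⟨m, h⟩) j)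
    else Finsupp.single m 1
  refine ⟨Finsupp.linearCombination R v, ?_, ?_⟩
  · ext m
    by_cases h : m ∈ r.support
    · have := hm (e ⟨m, h⟩)
      simp only [Equiv.symm_apply_apply] at this
      simp only [LinearMap.comp_apply, Finsupp.lsingle_apply, Finsupp.linearCombination_single,
        one_smul, proj_single, v, dif_pos h, map_sum]
      exact this.symm
    · simp only [LinearMap.comp_apply, Finsupp.lsingle_apply, Finsupp.linearCombination_single,
        one_smul, proj_single, v, dif_neg h]
  · rw [Finsupp.linearCombination_apply, Finsupp.sum, ← Finset.sum_coe_sort,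
      ← e.symm.sum_comp]
    have hv (i : Fin r.support.card) : r (e.symm i) • v (e.symm i) =
        ∑ j, Finsupp.single (m' j) (r (e.symm i) * a i j) := by
      simp only [v, dif_pos (e.symm i).2, Subtype.coe_eta, Equiv.apply_symm_apply,
        Finset.smul_sum, Finsupp.smul_single, smul_eq_mul]
    simp only [hv]
    rw [Finset.sum_comm]
    refine Finset.sum_eq_zero fun j _ => ?_
    rw [← Finsupp.single_finsetSum, ha j, Finsupp.single_zero]

/-- Over a flat module, finitely many relations are killed simultaneously by an endomorphism of
the free cover lying over the identity. -/
theorem exists_endo_forall_apply_eq_zero {R N ι : Type*} [Ring R] [AddCommGroup N] [Module R N]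
    (hflat : IsFlatModule R N) (P : Finset ι) (r : ι → N →₀ R) (hr : ∀ i, proj R N (r i) = 0) :
    ∃ φ : (N →₀ R) →ₗ[R] (N →₀ R), proj R N ∘ₗ φ = proj R N ∧ ∀ i ∈ P, φ (r i) = 0 := by
  classical
  induction P using Finset.induction_on with
  | empty => exact ⟨LinearMap.id, rfl, by simp⟩
  | insert i P _ ih =>
    obtain ⟨φ, hφ, hP⟩ := ih
    obtain ⟨χ, hχ, hi⟩ := exists_endo_apply_eq_zero hflat (φ (r i)) (by
      rw [← LinearMap.comp_apply, hφ, hr])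
    refine ⟨χ ∘ₗ φ, by rw [← LinearMap.comp_assoc, hχ, hφ], fun j hj => ?_⟩
    rcases Finset.mem_insert.1 hj with rfl | hj
    · exact hi
    · simp [hP j hj]

/-- For `M` flat over `S`, the kernel of the canonical map from the free `T`-module on `M` to
`T ⊗[S] M`. -/
def tensorKer (hflat : IsFlatModule S M) : Submodule T (M →₀ T) where
  carrier := {f | ∃ φ : (M →₀ S) →ₗ[S] (M →₀ S), proj S M ∘ₗ φ = proj S M ∧ extend φ f = 0}
  zero_mem' := ⟨LinearMap.id, rfl, map_zero _⟩
  smul_mem' := by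
    rintro t f ⟨φ, hφ, hf⟩
    exact ⟨φ, hφ, by rw [map_smul, hf, smul_zero]⟩
  add_mem' := by
    rintro f g ⟨φ, hφ, hf⟩ ⟨ψ, hψ, hg⟩
    obtain ⟨χ, hχ, h⟩ := exists_endo_forall_apply_eq_zero hflat g.support
      (fun m => φ (Finsupp.single m 1) - ψ (Finsupp.single m 1)) (fun m => by
        rw [map_sub, ← LinearMap.comp_apply, hφ, ← LinearMap.comp_apply, hψ, sub_self])
    refine ⟨χ ∘ₗ φ, by rw [← LinearMap.comp_assoc, hχ, hφ], ?_⟩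
    have hg' : extend (χ ∘ₗ φ) g = extend (χ ∘ₗ ψ) g :=
      extend_congr fun m hm => sub_eq_zero.1 (by simpa using h m hm)
    rw [map_add, hg', extend_comp, extend_comp, hf, hg, map_zero, add_zero]

theorem incl_mem_tensorKer (hflat : IsFlatModule S M) {r : M →₀ S} (hr : proj S M r = 0) :
    incl S M r ∈ tensorKer hflat := by
  obtain ⟨φ, hφ, h⟩ := exists_endo_apply_eq_zero hflat r hr
  exact ⟨φ, hφ, by rw [extend_incl, h, map_zero]⟩

theorem sum_single_mem_tensorKer (hflat : IsFlatModule S M) {n p : ℕ} {x y : Fin n → T}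
    (hω : IsSeparabilityIdempotent S.subtype x y) (t : Fin p → T) (m : Fin p → M)
    (h : ∑ k, t k • m k = 0) :
    ∑ k, ∑ i, Finsupp.single (y i • m k) (t k * x i) ∈ tensorKer hflat := by
  let q := (tensorKer hflat).mkQ
  have hq {f g : M →₀ T} (hfg : f - g ∈ tensorKer hflat) : q f = q g :=
    (Submodule.Quotient.eq _).2 hfg
  have hbal (k : Fin p) : ∑ i, q (Finsupp.single (y i • m k) (t k * x i)) =
      ∑ i, q (Finsupp.single ((y i * t k) • m k) (x i)) := by
    refine hω.sum_balanced_eq (fun a b => q (Finsupp.single (b • m k) a)) ?_ ?_ ?_ (t k)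
    · intro a b u
      rw [Finsupp.single_add, map_add]
    · intro a u v
      rw [← map_add]
      apply hq
      have hmem := (tensorKer hflat).smul_mem a (incl_mem_tensorKer hflat
        (r := Finsupp.single ((u + v) • m k) 1 -
          (Finsupp.single (u • m k) 1 + Finsupp.single (v • m k) 1))
        (by simp [add_smul]))
      simpa [smul_sub, smul_add] using hmem
    · intro s a u
      apply hq
      have hmem := (tensorKer hflat).smul_mem a (incl_mem_tensorKer hflat
        (r := Finsupp.single (u • m k) s - Finsupp.single (((s : T) * u) • m k) 1)
        (by simp [Subring.smul_def, mul_smul]))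
      simpa [smul_sub] using hmem
  rw [← Submodule.Quotient.mk_eq_zero]
  change q _ = 0
  simp only [map_sum, hbal]
  rw [Finset.sum_comm]
  refine Finset.sum_eq_zero fun i _ => ?_
  rw [← map_sum]
  refine (Submodule.Quotient.mk_eq_zero _).2 ?_
  have hmem := (tensorKer hflat).smul_mem (x i) (incl_mem_tensorKer hflat
    (r := ∑ k, Finsupp.single ((y i * t k) • m k) 1)
    (by simp [mul_smul, ← Finset.smul_sum, h]))
  simpa [Finset.smul_sum] using hmem

/-- A relation is trivial as soon as it lifts to the free cover. -/
theorem exists_trivialization {R N : Type*} [Ring R] [AddCommGroup N] [Module R N] {p : ℕ}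
    (t : Fin p → R) (m : Fin p → N) (z : Fin p → N →₀ R) (hz : ∀ k, proj R N (z k) = m k)
    (h : ∑ k, t k • z k = 0) :
    ∃ (l : ℕ) (a : Fin p → Fin l → R) (m' : Fin l → N),
      (∀ i, m i = ∑ j, a i j • m' j) ∧ ∀ j, (∑ i, t i * a i j) = 0 := by
  classical
  let P : Finset N := Finset.univ.biUnion fun k => (z k).support
  let e := P.equivFin
  refine ⟨P.card, fun k j => z k (e.symm j), fun j => e.symm j, fun k => ?_, fun j => ?_⟩
  · rw [e.symm.sum_comp (fun q : P => z k q • (q : N)),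
      Finset.sum_coe_sort P (fun q => z k q • q), ← hz k, proj,
      Finsupp.linearCombination_apply]
    exact Finsupp.sum_of_support_subset _
      (Finset.subset_biUnion_of_mem (fun k => (z k).support) (Finset.mem_univ k)) _ (by simp)
  · simpa [Finsupp.finsetSum_apply] using DFunLike.congr_fun h (e.symm j : N)

end FreeCover

/-- If the ring `T` is separable over a subring `S`, then every left
`T`-module that is flat as a left `S`-module is flat as a left `T`-module. -/
theorem flat_over_separable_extension
    {T : Type*} [Ring T] (S : Subring T)
    (hsep : IsSeparableExtension (S.subtype : S →+* T))
    (M : Type*) [AddCommGroup M] [Module T M]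
    (hflat : IsFlatModule S M) :
    IsFlatModule T M := by
  obtain ⟨n, x, y, hω⟩ := hsep
  intro p t m h
  obtain ⟨φ, hφ, hker⟩ := FreeCover.sum_single_mem_tensorKer hflat hω t m h
  refine FreeCover.exists_trivialization t m
    (fun k => ∑ i, x i • FreeCover.incl S M (φ (Finsupp.single (y i • m k) 1)))
    (fun k => ?_) ?_
  · have hproj (v : M) : FreeCover.proj S M (φ (Finsupp.single v 1)) = v := by
      rw [← LinearMap.comp_apply, hφ, FreeCover.proj_single, one_smul]
    simp only [map_sum, map_smul, FreeCover.proj_incl, hproj, ← mul_smul, ← Finset.sum_smul,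
      hω.1, one_smul]
  · simpa only [map_sum, FreeCover.extend_single, mul_smul, ← Finset.smul_sum] using hker
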